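/- The operator of left multiplication by ⁽ᵐ⁾Ш_{1,n-1} on the rational group algebra ℚG(m,1,n) is diagonalizable, with eigenvalues contained in {0, m, 2m, …, nm}, and the multiplicity of the eigenvalue i·m equals (n choose i)·d_{m,n−i}, the number of elements of G(m,1,n) with exactly i fixed points. -/

import Mathlib

open Finset Multiplicative

/-- The cyclic group of order `m` (written multiplicatively). -/
abbrev Cm (m : ℕ) : Type := Multiplicative (ZMod m)

/-- The action of `S_n` on `(C_m)^n` permuting coordinates. -/
def wrAct (m n : ℕ) : Equiv.Perm (Fin n) →* MulAut (Fin n → Cm m) where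
  toFun σ :=
    { toFun := fun f => f ∘ σ.symm
      invFun := fun f => f ∘ σ
      left_inv := fun f => by ext i; simp
      right_inv := fun f => by ext i; simp
      map_mul' := fun f g => rfl }
  map_one' := by ext f i; rfl
  map_mul' := fun σ τ => by ext f i; rfl

/-- The wreath product `C_m ≀ S_n = (C_m)^n ⋊ S_n`, i.e. the group `G(m,1,n)`. -/
abbrev GG (m n : ℕ) := (Fin n → Cm m) ⋊[wrAct m n] Equiv.Perm (Fin n)

def ggEquiv (m n : ℕ) : GG m n ≃ (Fin n → Cm m) × Equiv.Perm (Fin n) where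
  toFun g := (g.left, g.right)
  invFun p := ⟨p.1, p.2⟩
  left_inv _ := rfl
  right_inv _ := rfl

instance (m n : ℕ) [NeZero m] : Fintype (GG m n) :=
  Fintype.ofEquiv _ (ggEquiv m n).symm

instance (m n : ℕ) : DecidableEq (GG m n) := (ggEquiv m n).decidableEq

/-- The generator `s_{i+1}` of `G(m,1,n)`: the simple transposition `(i+1, i+2)`
(0-indexed: `sGen m n i` swaps positions `i` and `i+1`). -/
def sGen (m n : ℕ) (i : ℕ) : GG m n :=
  if h : i + 1 < n then
    SemidirectProduct.inr (Equiv.swap ⟨i, Nat.lt_of_succ_lt h⟩ ⟨i + 1, h⟩) else 1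

/-- The generator `t_{i+1}` of `G(m,1,n)`, rotating the `(i+1)`-st card (0-indexed). -/
def tGen (m n : ℕ) (i : ℕ) : GG m n :=
  if h : i < n then
    SemidirectProduct.inl (Pi.mulSingle ⟨i, h⟩ (ofAdd (1 : ZMod m))) else 1

/-- `⁽ᵐ⁾Ш_{1,k-1} = (1 + s_{k-1} + s_{k-2}s_{k-1} + ⋯ + s_1⋯s_{k-1})(1 + t_k + ⋯ + t_k^{m-1})`,
viewed inside `ℤ G(m,1,n)` (case `k = n` is the 1-shuffle element of `G(m,1,n)` itself). -/
noncomputable def msha (m n k : ℕ) : MonoidAlgebra ℤ (GG m n) :=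
  (∑ l ∈ Finset.range k, MonoidAlgebra.of ℤ (GG m n)
      (((List.range l).map (fun p => sGen m n (k - 1 - l + p))).prod)) *
  (∑ a ∈ Finset.range m, MonoidAlgebra.of ℤ (GG m n) (tGen m n (k - 1) ^ a))

/-- The 1-shuffle element `⁽ᵐ⁾Ш_{1,n-1}` in the rational group algebra `ℚ G(m,1,n)`. -/
noncomputable def mshaQ (m n : ℕ) : MonoidAlgebra ℚ (GG m n) :=
  (∑ l ∈ Finset.range n, MonoidAlgebra.of ℚ (GG m n)
      (((List.range l).map (fun p => sGen m n (n - 1 - l + p))).prod)) *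
  (∑ a ∈ Finset.range m, MonoidAlgebra.of ℚ (GG m n) (tGen m n (n - 1) ^ a))

/-- The `m`-derangement number `d_{m,k}`, the number of elements of `C_m ≀ S_k`
with no fixed points. -/
def dm (m k : ℕ) : ℤ :=
  ∑ j ∈ Finset.range (k + 1), (-1 : ℤ) ^ j * (k.choose j) * m ^ (k - j) * ((k - j).factorial)

section ProjectionsFromRecursion

/-- The coefficients expressing the eigenprojections of `x` in terms of a sequence `B` with
`x * B k = k m B k + B (k + 1)`. -/
noncomputable def projCoeff (m : ℚ) (i k : ℕ) : ℚ :=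
  (-1) ^ (k + i) * k.choose i / (m ^ k * k.factorial)

theorem projCoeff_succ {m : ℚ} (hm : m ≠ 0) (i k : ℕ) :
    projCoeff m i k + projCoeff m i (k + 1) * ((k + 1 - i) * m) = 0 := by
  have h : ((k + 1 : ℕ).choose i : ℚ) * (k + 1 - i) = (k.choose i) * (k + 1) := by
    rcases le_or_gt i (k + 1) with hi | hi
    · have := Nat.choose_mul_succ_eq k i
      have h2 : ((k + 1 - i : ℕ) : ℚ) = k + 1 - i := by push_cast [Nat.cast_sub hi]; ring
      rw [← h2]
      exact_mod_cast this.symm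
    · rw [Nat.choose_eq_zero_of_lt hi, Nat.choose_eq_zero_of_lt (by omega)]; simp
  have hk : (k.factorial : ℚ) ≠ 0 := by positivity
  have hk1 : (k + 1 : ℚ) ≠ 0 := by positivity
  unfold projCoeff
  rw [Nat.factorial_succ]
  push_cast
  field_simp
  linear_combination (-(-1 : ℚ) ^ (k + i) * m ^ (k + 1)) * h

theorem sum_projCoeff_mul_descFactorial {m : ℚ} (hm : m ≠ 0) {n i : ℕ} (hi : i ≤ n) :
    ∑ k ∈ range (n + 1), projCoeff m i k * ∏ j ∈ range k, ((i : ℚ) * m - j * m) = 1 := by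
  have hprod : ∀ k, ∏ j ∈ range k, ((i : ℚ) * m - j * m) = i.choose k * k.factorial * m ^ k := by
    intro k
    have : ∀ j, ((i : ℚ) * m - j * m) = (i - j) * m := fun j => by ring
    simp_rw [this]
    rw [prod_mul_distrib, prod_const, card_range]
    congr 1
    rw [mul_comm, ← Nat.cast_mul, ← Nat.descFactorial_eq_factorial_mul_choose]
    induction k with
    | zero => simp
    | succ k ih =>
      rw [prod_range_succ, ih, Nat.descFactorial_succ, Nat.cast_mul, mul_comm]
      rcases le_or_gt k i with h | h
      · rw [Nat.cast_sub h]
      · simp [Nat.descFactorial_of_lt h]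
  rw [sum_eq_single i]
  · rw [hprod]
    have : (i.factorial : ℚ) ≠ 0 := by positivity
    unfold projCoeff
    rw [← two_mul, pow_mul]
    simp
    field_simp
  · intro k _ hk
    rw [hprod]
    unfold projCoeff
    rcases lt_or_gt_of_ne hk with h | h
    · simp [Nat.choose_eq_zero_of_lt h]
    · simp [Nat.choose_eq_zero_of_lt h]
  · intro h
    simp only [mem_range] at h
    omega

theorem sum_projCoeff (m : ℚ) {n k : ℕ} (hk : k ≤ n) :
    ∑ i ∈ range (n + 1), projCoeff m i k = if k = 0 then 1 else 0 := by
  have h1 : ∑ i ∈ range (n + 1), projCoeff m i k = ∑ i ∈ range (k + 1), projCoeff m i k := by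
    symm
    apply sum_subset
    · intro i; simp only [mem_range]; omega
    · intro i _ hi
      simp only [mem_range] at hi
      simp [projCoeff, Nat.choose_eq_zero_of_lt (show k < i by omega)]
  have h2 : ∀ i, projCoeff m i k =
      (-1) ^ k / (m ^ k * k.factorial) * (((-1) ^ i * k.choose i : ℤ) : ℚ) := by
    intro i
    unfold projCoeff
    push_cast
    ring
  rw [h1]
  simp_rw [h2]
  rw [← mul_sum, ← Int.cast_sum, Int.alternating_sum_range_choose]
  split_ifs with h
  · subst h; simp
  · simp

variable {A : Type*} [Ring A] [Algebra ℚ A] {x : A} {B : ℕ → A} {m : ℚ} {n : ℕ}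

theorem mul_eq_prod_smul (h0 : B 0 = 1)
    (hrec : ∀ k : ℕ, x * B k = (k * m) • B k + B (k + 1)) {μ : ℚ} {v : A} (hv : x * v = μ • v)
    (k : ℕ) : B k * v = (∏ j ∈ range k, (μ - j * m)) • v := by
  induction k with
  | zero => simp [h0]
  | succ k ih =>
    have : B (k + 1) = x * B k - (k * m) • B k := by rw [hrec]; abel
    rw [this, sub_mul, mul_assoc, smul_mul_assoc, ih, mul_smul_comm, hv, prod_range_succ,
      smul_smul, smul_smul, ← sub_smul]
    congr 1
    ring

theorem mul_sum_projCoeff (hm : m ≠ 0)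
    (hrec : ∀ k : ℕ, x * B k = (k * m) • B k + B (k + 1)) (hn : B (n + 1) = 0) (i : ℕ) :
    x * ∑ k ∈ range (n + 1), projCoeff m i k • B k =
      ((i : ℚ) * m) • ∑ k ∈ range (n + 1), projCoeff m i k • B k := by
  have key : ∀ N, ∑ k ∈ range (N + 1), projCoeff m i k • ((k - i : ℚ) * m) • B k
      + ∑ k ∈ range (N + 1), projCoeff m i k • B (k + 1) = projCoeff m i N • B (N + 1) := by
    intro N
    induction N with
    | zero =>
      rcases Nat.eq_zero_or_pos i with rfl | hi
      · simp
      · simp [projCoeff, Nat.choose_eq_zero_of_lt hi]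
    | succ N ih =>
      rw [sum_range_succ, sum_range_succ _ (N + 1), add_add_add_comm, ih, ← add_assoc, smul_smul,
        ← add_smul]
      push_cast
      rw [projCoeff_succ hm, zero_smul, zero_add]
  have h := key n
  rw [hn, smul_zero, ← sum_add_distrib] at h
  rw [← sub_eq_zero, mul_sum, smul_sum, ← sum_sub_distrib, ← h]
  refine sum_congr rfl fun k _ => ?_
  rw [mul_smul_comm, hrec]
  module

theorem sum_sum_projCoeff (h0 : B 0 = 1) :
    ∑ i ∈ range (n + 1), ∑ k ∈ range (n + 1), projCoeff m i k • B k = 1 := by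
  rw [sum_comm, ← h0]
  calc _ = ∑ k ∈ range (n + 1), (if k = 0 then (1 : ℚ) else 0) • B k := by
        refine sum_congr rfl fun k hk => ?_
        rw [← sum_smul, sum_projCoeff m (by simpa [Nat.lt_succ_iff] using hk)]
    _ = B 0 := by simp

theorem iSup_eigenspace_mulLeft_eq_top (hm : m ≠ 0) (h0 : B 0 = 1)
    (hrec : ∀ k : ℕ, x * B k = (k * m) • B k + B (k + 1)) (hn : B (n + 1) = 0) :
    ⨆ μ : ℚ, Module.End.eigenspace (LinearMap.mulLeft ℚ x) μ = ⊤ := by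
  rw [eq_top_iff]
  intro v _
  have hv : v = ∑ i ∈ range (n + 1), (∑ k ∈ range (n + 1), projCoeff m i k • B k) * v := by
    rw [← sum_mul, sum_sum_projCoeff h0, one_mul]
  rw [hv]
  refine Submodule.sum_mem _ fun i _ => ?_
  refine Submodule.mem_iSup_of_mem ((i : ℚ) * m) ?_
  rw [Module.End.mem_eigenspace_iff, LinearMap.mulLeft_apply, ← mul_assoc,
    mul_sum_projCoeff hm hrec hn, smul_mul_assoc]

theorem eigenvalue_mulLeft (h0 : B 0 = 1)
    (hrec : ∀ k : ℕ, x * B k = (k * m) • B k + B (k + 1)) (hn : B (n + 1) = 0) {μ : ℚ}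
    (hμ : Module.End.HasEigenvalue (LinearMap.mulLeft ℚ x) μ) : ∃ i : ℕ, i ≤ n ∧ μ = i * m := by
  obtain ⟨v, hv⟩ := hμ.exists_hasEigenvector
  have h := mul_eq_prod_smul h0 hrec hv.apply_eq_smul (n + 1)
  rw [hn, zero_mul, eq_comm, smul_eq_zero_iff_left hv.2, prod_eq_zero_iff] at h
  obtain ⟨i, hi, h⟩ := h
  exact ⟨i, by simpa [Nat.lt_succ_iff] using hi, sub_eq_zero.1 h⟩

theorem isProj_eigenspace_mulLeft (hm : m ≠ 0) (h0 : B 0 = 1)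
    (hrec : ∀ k : ℕ, x * B k = (k * m) • B k + B (k + 1)) (hn : B (n + 1) = 0) {i : ℕ}
    (hi : i ≤ n) :
    LinearMap.IsProj (Module.End.eigenspace (LinearMap.mulLeft ℚ x) (i * m))
      (LinearMap.mulLeft ℚ (∑ k ∈ range (n + 1), projCoeff m i k • B k)) where
  map_mem v := by
    rw [Module.End.mem_eigenspace_iff, LinearMap.mulLeft_apply, LinearMap.mulLeft_apply,
      ← mul_assoc, mul_sum_projCoeff hm hrec hn, smul_mul_assoc]
  map_id v hv := by
    rw [Module.End.mem_eigenspace_iff, LinearMap.mulLeft_apply] at hv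
    rw [LinearMap.mulLeft_apply, sum_mul]
    simp_rw [smul_mul_assoc, mul_eq_prod_smul h0 hrec hv, smul_smul]
    rw [← sum_smul, sum_projCoeff_mul_descFactorial hm hi, one_smul]

end ProjectionsFromRecursion

theorem trace_mulLeft_monoidAlgebra {G : Type*} [Group G] [Fintype G] (a : MonoidAlgebra ℚ G) :
    LinearMap.trace ℚ _ (LinearMap.mulLeft ℚ a) = Fintype.card G * a.coeff 1 := by
  classical
  have h : ∀ g : G, (MonoidAlgebra.basis G ℚ).repr (a * MonoidAlgebra.basis G ℚ g) g = a.coeff 1 := by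
    intro g
    change (a * MonoidAlgebra.single g 1).coeff g = _
    simp
  rw [LinearMap.trace_eq_matrix_trace ℚ (MonoidAlgebra.basis G ℚ), Matrix.trace]
  simp only [Matrix.diag, LinearMap.toMatrix_apply, LinearMap.mulLeft_apply, h]
  simp

theorem card_mul_sum_projCoeff (m n i : ℕ) [NeZero m] (hi : i ≤ n) :
    (m ^ n * n.factorial : ℚ) * ∑ k ∈ range (n + 1), projCoeff m i k =
      ((n.choose i * dm m (n - i) : ℤ) : ℚ) := by
  obtain ⟨d, rfl⟩ := Nat.exists_eq_add_of_le hi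
  have hm : (m : ℚ) ≠ 0 := NeZero.ne _
  rw [add_assoc, sum_range_add, sum_eq_zero, zero_add]
  · rw [Nat.add_sub_cancel_left, dm]
    push_cast
    rw [mul_sum, mul_sum]
    refine sum_congr rfl fun j hj => ?_
    obtain ⟨r, rfl⟩ := Nat.exists_eq_add_of_le (show j ≤ d by simpa [Nat.lt_succ_iff] using hj)
    rw [projCoeff, Nat.add_sub_cancel_left, Nat.cast_add_choose, Nat.cast_add_choose,
      Nat.cast_add_choose]
    have h1 : ((i + j).factorial : ℚ) ≠ 0 := by positivity
    have h2 : (i.factorial : ℚ) ≠ 0 := by positivity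
    have h3 : (j.factorial : ℚ) ≠ 0 := by positivity
    have h4 : (r.factorial : ℚ) ≠ 0 := by positivity
    have h5 : ((j + r).factorial : ℚ) ≠ 0 := by positivity
    have h6 : (-1 : ℚ) ^ (i + j + i) = (-1) ^ j := by
      rw [show i + j + i = 2 * i + j by ring, pow_add, pow_mul]; simp
    rw [h6]
    field_simp
    ring
  · intro k hk
    simp [projCoeff, Nat.choose_eq_zero_of_lt (mem_range.1 hk)]

/-- The product `s_{n-l} ⋯ s_{n-1}` moving the last card to position `n - 1 - l` (0-indexed). -/
def moveWord (m n l : ℕ) : GG m n :=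
  ((List.range l).map fun p => sGen m n (n - 1 - l + p)).prod

theorem moveWord_succ {m n l : ℕ} (hl : l + 1 < n) :
    moveWord m n (l + 1) = sGen m n (n - 2 - l) * moveWord m n l := by
  unfold moveWord
  rw [List.range_succ_eq_map, List.map_cons, List.prod_cons, List.map_map]
  congr 2
  · omega
  · refine List.map_congr_left fun p _ => ?_
    simp only [Function.comp]
    congr 1
    omega

theorem moveWord_left {m n l : ℕ} (hl : l < n) : (moveWord m n l).left = 1 := by
  induction l with
  | zero => simp [moveWord]
  | succ l ih =>
    rw [moveWord_succ hl, sGen, dif_pos (by omega), SemidirectProduct.mul_left, ih (by omega)]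
    simp

theorem moveWord_right_symm {m n l : ℕ} (hl : l < n) (q : Fin n) :
    ((moveWord m n l).right.symm q : ℕ) =
      if (q : ℕ) < n - 1 - l then (q : ℕ) else if (q : ℕ) = n - 1 - l then n - 1 else q - 1 := by
  induction l generalizing q with
  | zero =>
    have : (moveWord m n 0).right.symm q = q := by simp only [moveWord]; rfl
    rw [this]
    split_ifs <;> omega
  | succ l ih =>
    rw [moveWord_succ hl, sGen, dif_pos (by omega), SemidirectProduct.mul_right]
    simp only [SemidirectProduct.right_inr, Equiv.Perm.mul_def, Equiv.symm_trans_apply,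
      Equiv.symm_swap]
    rw [ih (by omega), Equiv.swap_apply_def]
    simp only [Fin.ext_iff, apply_ite Fin.val]
    split_ifs <;> omega

theorem tGen_pow {m n : ℕ} (h : n - 1 < n) (a : ℕ) :
    tGen m n (n - 1) ^ a =
      SemidirectProduct.inl (Pi.mulSingle ⟨n - 1, h⟩ (ofAdd (1 : ZMod m) ^ a)) := by
  rw [tGen, dif_pos h, ← map_pow, Pi.mulSingle_pow]

/-- The shuffle moving the last card to position `p`, rotating it `a` times. -/
def moveElt (m n p a : ℕ) : GG m n := moveWord m n (n - 1 - p) * tGen m n (n - 1) ^ a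

theorem moveElt_right_symm {m n : ℕ} (p : Fin n) (a : ℕ) (q : Fin n) :
    ((moveElt m n p a).right.symm q : ℕ) =
      if q < p then (q : ℕ) else if q = p then n - 1 else q - 1 := by
  have hp := p.2
  rw [moveElt, tGen_pow (by omega), SemidirectProduct.mul_right, SemidirectProduct.right_inl,
    mul_one, moveWord_right_symm (by omega), show n - 1 - (n - 1 - (p : ℕ)) = p by omega]
  simp only [Fin.lt_def, Fin.ext_iff]

theorem moveElt_right_symm_lt {m n : ℕ} (p : Fin n) (a : ℕ) (q r : Fin n) :
    (moveElt m n p a).right.symm q < (moveElt m n p a).right.symm r ↔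
      q ≠ p ∧ (r = p ∨ q < r) := by
  rw [Fin.lt_def, moveElt_right_symm, moveElt_right_symm]
  simp only [Fin.lt_def, Fin.ext_iff, ne_eq]
  split_ifs <;> omega

theorem moveElt_left {m n : ℕ} (p : Fin n) (a : ℕ) :
    (moveElt m n p a).left = Pi.mulSingle p (ofAdd (1 : ZMod m) ^ a) := by
  have hp := p.2
  have hr := moveElt_right_symm (m := m) p a
  rw [moveElt, tGen_pow (by omega), SemidirectProduct.mul_right, SemidirectProduct.right_inl,
    mul_one] at hr
  rw [moveElt, tGen_pow (by omega), SemidirectProduct.mul_left, SemidirectProduct.left_inl,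
    moveWord_left (by omega), one_mul]
  funext q
  change Pi.mulSingle _ _ ((moveWord m n (n - 1 - p)).right.symm q) = _
  have : (moveWord m n (n - 1 - p)).right.symm q = ⟨n - 1, by omega⟩ ↔ q = p := by
    rw [Fin.ext_iff, hr q]
    simp only [Fin.lt_def, Fin.ext_iff]
    split_ifs <;> simp_all <;> omega
  simp only [Pi.mulSingle_apply, this]

theorem mshaQ_eq (m n : ℕ) :
    mshaQ m n = ∑ p : Fin n, ∑ a ∈ range m, MonoidAlgebra.of ℚ (GG m n) (moveElt m n p a) := by
  rw [Fin.sum_univ_eq_sum_range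
    (fun p => ∑ a ∈ range m, MonoidAlgebra.of ℚ (GG m n) (moveElt m n p a)),
    mshaQ, sum_mul, ← sum_range_reflect]
  refine sum_congr rfl fun p _ => ?_
  rw [mul_sum]
  refine sum_congr rfl fun a _ => ?_
  rw [moveElt, map_mul]
  rfl

/-- The first `n - k` cards are unrotated and appear in their original relative order. -/
def IsFirstSorted {m n : ℕ} (k : ℕ) (z : GG m n) : Prop :=
  k ≤ n ∧ ∀ i : Fin n, i + k < n → z.left (z.right i) = 1 ∧
    ∀ j : Fin n, i < j → j + k < n → z.right i < z.right j

theorem isFirstSorted_one {m n k : ℕ} (hk : k ≤ n) : IsFirstSorted k (1 : GG m n) :=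
  ⟨hk, fun _ _ => ⟨rfl, fun _ h _ => h⟩⟩

theorem isFirstSorted_zero_iff {m n : ℕ} (z : GG m n) : IsFirstSorted 0 z ↔ z = 1 := by
  refine ⟨fun ⟨_, h⟩ => ?_, fun h => h ▸ isFirstSorted_one (Nat.zero_le _)⟩
  have hr : z.right = 1 := by
    have hs : StrictMono z.right := fun i j hij => (h i i.2).2 j hij j.2
    have := Subsingleton.elim (hs.orderIsoOfSurjective _ z.right.surjective)
      (OrderIso.refl (Fin n))
    ext i
    exact congrArg Fin.val (DFunLike.congr_fun this i)
  refine SemidirectProduct.ext ?_ hr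
  funext q
  simpa [hr] using (h q q.2).1

theorem isFirstSorted_inv_mul_iff {m n k : ℕ} (z : GG m n) (p : Fin n) (a : ℕ) :
    IsFirstSorted k ((moveElt m n (z.right p) a)⁻¹ * z) ↔
      k ≤ n ∧ ∀ i : Fin n, i + k < n →
        z.left (z.right i) = (if i = p then ofAdd (1 : ZMod m) ^ a else 1) ∧
        ∀ j : Fin n, i < j → j + k < n → i ≠ p ∧ (j = p ∨ z.right i < z.right j) := by
  set x := moveElt m n (z.right p) a
  have hright : ∀ i, (x⁻¹ * z).right i = x.right.symm (z.right i) := fun i => rfl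
  have hleft : ∀ i, (x⁻¹ * z).left ((x⁻¹ * z).right i) =
      (x.left (z.right i))⁻¹ * z.left (z.right i) := by
    intro i
    have h : ∀ q, (x⁻¹ * z).left q = (x.left (x.right q))⁻¹ * z.left (x.right q) := fun q => rfl
    rw [h, hright, Equiv.apply_symm_apply]
  have hxleft : x.left = _ := moveElt_left (z.right p) a
  have hxlt : ∀ q r, x.right.symm q < x.right.symm r ↔ _ :=
    moveElt_right_symm_lt (m := m) (z.right p) a
  unfold IsFirstSorted
  simp only [hleft]
  simp only [hright, inv_mul_eq_one, hxleft, hxlt,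
    Pi.mulSingle_apply, EmbeddingLike.apply_eq_iff_eq, ne_eq, eq_comm (b := z.left _)]

theorem isFirstSorted_inv_mul_of_le {m n k : ℕ} (z : GG m n) {p : Fin n} (a : ℕ)
    (hp : n ≤ p + k) :
    IsFirstSorted k ((moveElt m n (z.right p) a)⁻¹ * z) ↔ IsFirstSorted k z := by
  rw [isFirstSorted_inv_mul_iff, IsFirstSorted]
  have hne : ∀ i : Fin n, i + k < n → i ≠ p := by rintro i hi rfl; omega
  refine and_congr_right fun _ => forall₂_congr fun i hi => ?_
  simp only [hne i hi, if_false, ne_eq, not_false_eq_true, true_and]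
  refine and_congr_right fun _ => forall₃_congr fun j _ hj => ?_
  simp [hne j hj]

theorem isFirstSorted_inv_mul_of_eq {m n k : ℕ} (z : GG m n) {p : Fin n} (a : ℕ)
    (hp : p + k + 1 = n) :
    IsFirstSorted k ((moveElt m n (z.right p) a)⁻¹ * z) ↔
      IsFirstSorted (k + 1) z ∧ z.left (z.right p) = ofAdd (1 : ZMod m) ^ a := by
  rw [isFirstSorted_inv_mul_iff, IsFirstSorted]
  have hne : ∀ i : Fin n, i + (k + 1) < n → i ≠ p := by rintro i hi rfl; omega
  constructor
  · rintro ⟨_, h⟩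
    refine ⟨⟨by omega, fun i hi => ?_⟩, by simpa using (h p (by omega)).1⟩
    obtain ⟨h1, h2⟩ := h i (by omega)
    refine ⟨by simpa [hne i hi] using h1, fun j hij hj => ?_⟩
    simpa [hne i hi, hne j hj] using h2 j hij (by omega)
  · rintro ⟨⟨_, h⟩, hpa⟩
    refine ⟨by omega, fun i hi => ?_⟩
    by_cases hip : i = p
    · subst hip
      refine ⟨by simpa using hpa, fun j hij hj => ?_⟩
      rw [Fin.lt_def] at hij
      omega
    · have hi' : (i : ℕ) + (k + 1) < n := by
        have : (i : ℕ) ≠ p := fun h => hip (Fin.ext h)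
        omega
      obtain ⟨h1, h2⟩ := h i hi'
      refine ⟨by simpa [hip] using h1, fun j hij hj => ⟨hip, ?_⟩⟩
      by_cases hjp : j = p
      · exact Or.inl hjp
      · refine Or.inr (h2 j hij ?_)
        have : (j : ℕ) ≠ p := fun h => hjp (Fin.ext h)
        omega

theorem not_isFirstSorted_inv_mul {m n k : ℕ} (z : GG m n) {p : Fin n} (a : ℕ)
    (hp : p + k + 1 < n) : ¬ IsFirstSorted k ((moveElt m n (z.right p) a)⁻¹ * z) := by
  rw [isFirstSorted_inv_mul_iff]
  rintro ⟨_, h⟩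
  exact ((h p (by omega)).2 ⟨p + 1, by omega⟩ (by simp [Fin.lt_def])
    (by simp only; omega)).1 rfl

open Classical in
/-- The sum of all elements of `G(m,1,n)` keeping the first `n - k` cards unrotated and in order. -/
noncomputable def sortedSum (m n k : ℕ) [NeZero m] : MonoidAlgebra ℚ (GG m n) :=
  .ofCoeff (Finsupp.equivFunOnFinite.symm fun z => if IsFirstSorted k z then 1 else 0)

open Classical in
theorem coeff_sortedSum {m n k : ℕ} [NeZero m] (z : GG m n) :
    (sortedSum m n k).coeff z = if IsFirstSorted k z then 1 else 0 := rfl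

theorem sortedSum_zero (m n : ℕ) [NeZero m] : sortedSum m n 0 = 1 := by
  classical
  ext z
  rw [coeff_sortedSum, isFirstSorted_zero_iff, MonoidAlgebra.one_def, MonoidAlgebra.coeff_single,
    Finsupp.single_apply]
  by_cases h : z = 1
  · simp [h]
  · rw [if_neg h, if_neg (Ne.symm h)]

theorem sortedSum_of_lt {m n k : ℕ} [NeZero m] (hk : n < k) : sortedSum m n k = 0 := by
  classical
  ext z
  rw [coeff_sortedSum, if_neg fun h => absurd h.1 (by omega)]
  rfl

theorem sum_range_ite_ofAdd_pow {m : ℕ} [NeZero m] (u : Cm m) :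
    ∑ a ∈ range m, (if u = ofAdd (1 : ZMod m) ^ a then (1 : ℚ) else 0) = 1 := by
  have hu : ∀ a ∈ range m, u = ofAdd (1 : ZMod m) ^ a ↔ a = (toAdd u).val := by
    intro a ha
    rw [← ofAdd_nsmul, nsmul_one, eq_comm, ← toAdd.injective.eq_iff, toAdd_ofAdd]
    constructor
    · rintro h
      rw [← h, ZMod.val_natCast_of_lt (mem_range.1 ha)]
    · rintro rfl
      simp
  rw [sum_congr rfl fun a ha => if_congr (hu a ha) rfl rfl, sum_ite_eq', if_pos]
  exact mem_range.2 (ZMod.val_lt _)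

open Classical in
theorem sum_range_isFirstSorted {m n k : ℕ} [NeZero m] (z : GG m n) (p : Fin n) :
    ∑ a ∈ range m, (if IsFirstSorted k ((moveElt m n (z.right p) a)⁻¹ * z) then (1 : ℚ) else 0) =
      (if n ≤ p + k then (m : ℚ) * (if IsFirstSorted k z then 1 else 0) else 0) +
      (if p + k + 1 = n then (if IsFirstSorted (k + 1) z then 1 else 0) else 0) := by
  rcases lt_trichotomy (p + k + 1 : ℕ) n with h | h | h
  · simp only [not_isFirstSorted_inv_mul z _ h]
    rw [if_neg (show ¬n ≤ p + k by omega), if_neg (show ¬p + k + 1 = n by omega)]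
    simp
  · simp only [isFirstSorted_inv_mul_of_eq z _ h, ite_and]
    rw [if_neg (by omega), if_pos h]
    split_ifs
    · rw [sum_range_ite_ofAdd_pow, zero_add]
    · simp
  · simp only [isFirstSorted_inv_mul_of_le z _ (show n ≤ p + k by omega)]
    rw [if_pos (show n ≤ p + k by omega), if_neg (show ¬p + k + 1 = n by omega)]
    simp

theorem mshaQ_mul_sortedSum (m n : ℕ) [NeZero m] (k : ℕ) :
    mshaQ m n * sortedSum m n k =
      ((k : ℚ) * m) • sortedSum m n k + sortedSum m n (k + 1) := by
  classical
  rcases lt_or_ge n k with hk | hk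
  · simp [sortedSum_of_lt hk, sortedSum_of_lt (Nat.lt_succ_of_lt hk)]
  ext z
  rw [mshaQ_eq, sum_mul]
  simp only [sum_mul, MonoidAlgebra.coeff_sum, Finsupp.finsetSum_apply, MonoidAlgebra.of_apply,
    MonoidAlgebra.coeff_single_mul_apply, one_mul, MonoidAlgebra.coeff_add,
    MonoidAlgebra.coeff_smul, Finsupp.add_apply, Finsupp.smul_apply, coeff_sortedSum]
  rw [← Equiv.sum_comp z.right]
  simp only [sum_range_isFirstSorted]
  rw [Fin.sum_univ_eq_sum_range (fun p =>
    (if n ≤ p + k then (m : ℚ) * (if IsFirstSorted k z then 1 else 0) else 0) +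
      (if p + k + 1 = n then (if IsFirstSorted (k + 1) z then (1 : ℚ) else 0) else 0)),
    sum_add_distrib]
  congr 1
  · obtain ⟨r, rfl⟩ := Nat.exists_eq_add_of_le' hk
    rw [sum_range_add, sum_eq_zero fun p hp => if_neg (by have := mem_range.1 hp; omega),
      sum_congr rfl fun p _ => if_pos (by omega)]
    simp
  · rcases hk.eq_or_lt with rfl | hk
    · rw [sum_eq_zero fun p _ => if_neg (by omega), if_neg fun h => absurd h.1 (by omega)]
    · rw [sum_eq_single (n - k - 1) (fun p _ hp => if_neg (by omega))
        (fun h => absurd (mem_range.2 (by omega)) h), if_pos (by omega)]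

theorem card_GG (m n : ℕ) [NeZero m] : Fintype.card (GG m n) = m ^ n * n.factorial := by
  rw [Fintype.card_congr (ggEquiv m n)]
  simp [Fintype.card_perm, ZMod.card]

/-- Left multiplication by `⁽ᵐ⁾Ш_{1,n-1}` on `ℚ G(m,1,n)` is
diagonalizable, its eigenvalues lie in `{0, m, 2m, …, nm}`, and the multiplicity of the
eigenvalue `i·m` is `(n choose i)·d_{m,n−i}`, the number of elements of `G(m,1,n)` with
exactly `i` fixed points. -/
theorem msha_diagonalizable (m n : ℕ) [NeZero m] :
    (⨆ μ : ℚ, Module.End.eigenspace (LinearMap.mulLeft ℚ (mshaQ m n)) μ) = ⊤ ∧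
    (∀ μ : ℚ, Module.End.HasEigenvalue (LinearMap.mulLeft ℚ (mshaQ m n)) μ →
      ∃ i : ℕ, i ≤ n ∧ μ = i * m) ∧
    (∀ i : ℕ, i ≤ n →
      (Module.finrank ℚ
          (Module.End.eigenspace (LinearMap.mulLeft ℚ (mshaQ m n)) (i * m)) : ℤ) =
        (n.choose i) * dm m (n - i)) := by
  have hm : (m : ℚ) ≠ 0 := NeZero.ne _
  have h0 := sortedSum_zero m n
  have hrec := mshaQ_mul_sortedSum m n
  have hn := sortedSum_of_lt (m := m) (Nat.lt_succ_self n)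
  refine ⟨iSup_eigenspace_mulLeft_eq_top hm h0 hrec hn,
    fun μ hμ => eigenvalue_mulLeft h0 hrec hn hμ, fun i hi => ?_⟩
  have : Module.Finite ℚ (MonoidAlgebra ℚ (GG m n)) :=
    .of_basis (MonoidAlgebra.basis (GG m n) ℚ)
  have htr := (isProj_eigenspace_mulLeft hm h0 hrec hn hi).trace
  have hcoeff : (∑ k ∈ range (n + 1), projCoeff m i k • sortedSum m n k).coeff 1 =
      ∑ k ∈ range (n + 1), projCoeff m i k := by
    rw [MonoidAlgebra.coeff_sum, Finsupp.finsetSum_apply]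
    refine sum_congr rfl fun k hk => ?_
    rw [MonoidAlgebra.coeff_smul_apply, coeff_sortedSum,
      if_pos (isFirstSorted_one (Nat.lt_succ_iff.1 (mem_range.1 hk))), smul_eq_mul, mul_one]
  rw [trace_mulLeft_monoidAlgebra, hcoeff, card_GG, Nat.cast_mul, Nat.cast_pow,
    card_mul_sum_projCoeff m n i hi] at htr
  exact_mod_cast htr.symm
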